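/- Suppose the field F has characteristic 2 and every element of F is a square. Then every symmetric n×n matrix X over F is U-congruent to a unique specialized pseudo-permutation matrix; that is, there is exactly one specialized pseudo-permutation matrix Y such that Y = h'Xh for some h ∈ U. -/

import Mathlib

open Matrix

variable {F : Type*} [Field F] {n : ℕ}

/-- Membership in `U`: upper triangular matrices with all diagonal entries 1. -/
def InU (h : Matrix (Fin n) (Fin n) F) : Prop :=
  (∀ i, h i i = 1) ∧ ∀ i j : Fin n, j < i → h i j = 0

/-- A pseudo-permutation: a symmetric matrix such that every column has at most two
nonzero entries, and if column `j` has two nonzero entries then they are `X j j`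
and `X i j` for some `i < j`. -/
def IsPseudoPerm (X : Matrix (Fin n) (Fin n) F) : Prop :=
  X.IsSymm ∧
  (∀ j i k : Fin n, i ≠ j → k ≠ j → X i j ≠ 0 → X k j ≠ 0 → i = k) ∧
  (∀ j i : Fin n, i ≠ j → X i j ≠ 0 → X j j ≠ 0 → i < j)

/-- An `X`-pair: `i < j` with `X i j ≠ 0` and `X j j ≠ 0`. -/
def XPair (X : Matrix (Fin n) (Fin n) F) (i j : Fin n) : Prop :=
  i < j ∧ X i j ≠ 0 ∧ X j j ≠ 0

/-- An `X`-index: `s` with `X s s ≠ 0` the only nonzero entry in column `s`. -/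
def XIndex (X : Matrix (Fin n) (Fin n) F) (s : Fin n) : Prop :=
  X s s ≠ 0 ∧ ∀ i, X i s ≠ 0 → i = s

/-- An `X`-pair `(i,j)` is problematic if some `X`-pair is inside it or some
`X`-index is interior to it. -/
def ProblematicPair (X : Matrix (Fin n) (Fin n) F) (i j : Fin n) : Prop :=
  (∃ k l : Fin n, XPair X k l ∧ i < k ∧ l < j) ∨
  (∃ s : Fin n, XIndex X s ∧ i < s ∧ s < j)

/-- A specialized pseudo-permutation: a pseudo-permutation with no problematic
`X`-pairs. -/
def IsSpecializedPseudoPerm (X : Matrix (Fin n) (Fin n) F) : Prop :=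
  IsPseudoPerm X ∧ ∀ i j : Fin n, XPair X i j → ¬ ProblematicPair X i j

/-- `U`-congruence of matrices. -/
def UCongr (X Y : Matrix (Fin n) (Fin n) F) : Prop :=
  ∃ h : Matrix (Fin n) (Fin n) F, InU h ∧ Y = hᵀ * X * h

theorem InU.one : InU (1 : Matrix (Fin n) (Fin n) F) :=
  ⟨fun i => by simp, fun i j hij => by simp [hij.ne']⟩

theorem InU.mul {g h : Matrix (Fin n) (Fin n) F} (hg : InU g) (hh : InU h) : InU (g * h) := by
  refine ⟨fun i => ?_, fun i j hij => ?_⟩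
  · rw [Matrix.mul_apply, Finset.sum_eq_single i]
    · rw [hg.1, hh.1, one_mul]
    · intro k _ hk
      rcases lt_or_gt_of_ne hk with hk | hk
      · rw [hg.2 i k hk, zero_mul]
      · rw [hh.2 k i hk, mul_zero]
    · simp
  · rw [Matrix.mul_apply]
    refine Finset.sum_eq_zero fun k _ => ?_
    rcases lt_or_ge k i with hk | hk
    · rw [hg.2 i k hk, zero_mul]
    · rw [hh.2 k j (hij.trans_le hk), mul_zero]

theorem InU.exists_inverse {h : Matrix (Fin n) (Fin n) F} (hh : InU h) :
    ∃ g, InU g ∧ h * g = 1 ∧ g * h = 1 := by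
  have htri : h.BlockTriangular id := fun i j hij => hh.2 i j hij
  have hdet : IsUnit h.det := by
    rw [Matrix.det_of_isUpperTriangular htri]
    simp [hh.1]
  have : Invertible h := h.invertibleOfIsUnitDet hdet
  have hinv : h⁻¹.BlockTriangular id := Matrix.blockTriangular_inv_of_blockTriangular htri
  have hmul : h * h⁻¹ = 1 := Matrix.mul_nonsing_inv h hdet
  refine ⟨h⁻¹, ⟨fun i => ?_, fun i j hij => hinv hij⟩, hmul, Matrix.nonsing_inv_mul h hdet⟩
  have hii := congrFun (congrFun hmul i) i
  rw [Matrix.mul_apply, Finset.sum_eq_single i, hh.1, one_mul, Matrix.one_apply_eq] at hii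
  · exact hii
  · intro k _ hk
    rcases lt_or_gt_of_ne hk with hk | hk
    · rw [hh.2 i k hk, zero_mul]
    · rw [hinv hk, mul_zero]
  · simp

theorem UCongr.refl (X : Matrix (Fin n) (Fin n) F) : UCongr X X :=
  ⟨1, InU.one, by simp⟩

theorem UCongr.trans {X Y Z : Matrix (Fin n) (Fin n) F} (h₁ : UCongr X Y) (h₂ : UCongr Y Z) :
    UCongr X Z := by
  obtain ⟨g, hg, rfl⟩ := h₁
  obtain ⟨h, hh, rfl⟩ := h₂
  exact ⟨g * h, hg.mul hh, by simp only [Matrix.transpose_mul, Matrix.mul_assoc]⟩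

theorem UCongr.symm {X Y : Matrix (Fin n) (Fin n) F} (h₁ : UCongr X Y) : UCongr Y X := by
  obtain ⟨h, hh, rfl⟩ := h₁
  obtain ⟨g, hg, hhg, -⟩ := hh.exists_inverse
  refine ⟨g, hg, ?_⟩
  have ht : gᵀ * hᵀ = 1 := by rw [← Matrix.transpose_mul, hhg, Matrix.transpose_one]
  calc X = (gᵀ * hᵀ) * X * (h * g) := by rw [ht, hhg, Matrix.one_mul, Matrix.mul_one]
    _ = _ := by simp only [Matrix.mul_assoc]

theorem UCongr.isSymm {X Y : Matrix (Fin n) (Fin n) F} (h₁ : UCongr X Y) (hX : X.IsSymm) :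
    Y.IsSymm := by
  obtain ⟨h, -, rfl⟩ := h₁
  simp [Matrix.IsSymm, Matrix.transpose_mul, hX.eq, Matrix.mul_assoc]

/-! ### Uniqueness -/

/-- The position `(i, j)`, `i ≤ j`, is a pivot of `X` if `X j i` is the only nonzero entry of
column `i`. -/
def IsPivot (X : Matrix (Fin n) (Fin n) F) (i j : Fin n) : Prop :=
  i ≤ j ∧ X j i ≠ 0 ∧ ∀ k, X k i ≠ 0 → k = j

theorem IsPseudoPerm.isPivot_of_lt {X : Matrix (Fin n) (Fin n) F} (hX : IsPseudoPerm X)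
    {i j : Fin n} (hij : i < j) (h : X j i ≠ 0) : IsPivot X i j := by
  refine ⟨hij.le, h, fun k hk => ?_⟩
  by_cases hki : k = i
  · subst hki
    exact absurd (hX.2.2 k j hij.ne' h hk) (not_lt_of_gt hij)
  · exact hX.2.1 i k j hki hij.ne' hk h

theorem IsPseudoPerm.eq_of_isPivot {X : Matrix (Fin n) (Fin n) F} (hX : IsPseudoPerm X)
    {i j l : Fin n} (hij : IsPivot X i j) (hl : l ≤ i) (h : X j l ≠ 0) : l = i := by
  have hlj : X l j ≠ 0 := by rwa [hX.1.apply]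
  rcases hij.1.lt_or_eq with hlt | rfl
  · exact hX.2.1 j l i (hl.trans_lt hlt).ne hlt.ne hlj (by rw [hX.1.apply]; exact hij.2.1)
  · exact hij.2.2 l hlj

theorem IsPivot.mul_apply_of_mul_eq {X Y g h : Matrix (Fin n) (Fin n) F} (hh : InU h)
    (hXY : Y * g = hᵀ * X) {i j : Fin n} (hij : IsPivot X i j) :
    (Y * g) j i = X j i := by
  rw [hXY, Matrix.mul_apply, Finset.sum_eq_single j]
  · rw [Matrix.transpose_apply, hh.1, one_mul]
  · intro k _ hk
    by_cases h0 : X k i = 0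
    · rw [h0, mul_zero]
    · exact absurd (hij.2.2 k h0) hk
  · simp

theorem exists_mul_eq_of_uCongr {X Y : Matrix (Fin n) (Fin n) F} (h : UCongr X Y) :
    ∃ g h, InU g ∧ InU h ∧ Y * g = hᵀ * X := by
  obtain ⟨h, hh, rfl⟩ := h
  obtain ⟨g, hg, hhg, -⟩ := hh.exists_inverse
  exact ⟨g, h, hg, hh, by rw [Matrix.mul_assoc, hhg, Matrix.mul_one]⟩

theorem IsPivot.exists_le_of_uCongr {X Y : Matrix (Fin n) (Fin n) F} (hY : IsPseudoPerm Y)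
    (hXY : UCongr X Y) {i j : Fin n} (hij : IsPivot X i j) : ∃ l ≤ i, IsPivot Y l j := by
  obtain ⟨g, h, hg, hh, he⟩ := exists_mul_eq_of_uCongr hXY
  have h1 : (Y * g) j i ≠ 0 := by
    rw [hij.mul_apply_of_mul_eq hh he]; exact hij.2.1
  rw [Matrix.mul_apply] at h1
  obtain ⟨l, -, hl⟩ := Finset.exists_ne_zero_of_sum_ne_zero h1
  have hl1 : Y j l ≠ 0 := left_ne_zero_of_mul hl
  have hl2 : l ≤ i := by
    by_contra hlt
    exact right_ne_zero_of_mul hl (hg.2 l i (not_le.1 hlt))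
  by_cases hex : ∃ k < j, Y j k ≠ 0 ∧ k ≤ i
  · obtain ⟨k, hk, hjk, hki⟩ := hex
    exact ⟨k, hki, hY.isPivot_of_lt hk hjk⟩
  · push Not at hex
    have hlj : l = j := by
      by_contra hne
      exact absurd hl2 (not_le.2 (hex l (lt_of_le_of_ne (hl2.trans hij.1) hne) hl1))
    subst hlj
    refine ⟨l, hl2, le_rfl, hl1, fun k hk => ?_⟩
    by_contra hkl
    have hkl' : k < l := hY.2.2 l k hkl hk hl1
    exact absurd (hkl'.le.trans hl2) (not_le.2 (hex k hkl' (by rwa [hY.1.apply])))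

theorem IsPivot.apply_eq_of_uCongr {X Y : Matrix (Fin n) (Fin n) F} (hX : IsPseudoPerm X)
    (hY : IsPseudoPerm Y) (hXY : UCongr X Y) {i j : Fin n} (hij : IsPivot X i j) :
    Y j i = X j i := by
  obtain ⟨l, hli, hl⟩ := hij.exists_le_of_uCongr hY hXY
  obtain ⟨k, hkl, hk⟩ := hl.exists_le_of_uCongr hX hXY.symm
  have hki := hX.eq_of_isPivot hij (hkl.trans hli) hk.2.1
  have : l = i := le_antisymm hli (hki ▸ hkl)
  subst this
  obtain ⟨g, h, hg, hh, he⟩ := exists_mul_eq_of_uCongr hXY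
  rw [← hij.mul_apply_of_mul_eq hh he, Matrix.mul_apply, Finset.sum_eq_single l]
  · rw [hg.1, mul_one]
  · intro m _ hm
    rcases lt_or_gt_of_ne hm with hm | hm
    · by_cases h0 : Y j m = 0
      · rw [h0, zero_mul]
      · exact absurd (hY.eq_of_isPivot hl hm.le h0) hm.ne
    · rw [hg.2 m l hm, mul_zero]
  · simp

theorem IsPseudoPerm.apply_eq_of_lt_of_ne_zero {X Y : Matrix (Fin n) (Fin n) F}
    (hX : IsPseudoPerm X) (hY : IsPseudoPerm Y) (hXY : UCongr X Y) {i j : Fin n} (hij : i < j)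
    (h : X i j ≠ 0) : Y i j = X i j := by
  rw [← hX.1.apply i j, ← hY.1.apply i j]
  exact (hX.isPivot_of_lt hij (by rwa [hX.1.apply])).apply_eq_of_uCongr hX hY hXY

/-- In characteristic two the quadratic form of a symmetric matrix is diagonal. -/
theorem dotProduct_mulVec_self_of_two_eq_zero (hchar : (2 : F) = 0)
    {X : Matrix (Fin n) (Fin n) F} (hX : X.IsSymm) (v : Fin n → F) :
    v ⬝ᵥ X *ᵥ v = ∑ k, v k ^ 2 * X k k := by
  have : CharP F 2 := CharTwo.of_one_ne_zero_of_two_eq_zero one_ne_zero hchar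
  have key : ∀ s : Finset (Fin n), ∑ a ∈ s, ∑ b ∈ s, v a * (X a b * v b) =
      ∑ k ∈ s, v k ^ 2 * X k k := by
    intro s
    induction s using Finset.induction_on with
    | empty => simp
    | insert a s ha ih =>
      rw [Finset.sum_insert ha, Finset.sum_insert ha, Finset.sum_insert ha]
      simp only [Finset.sum_insert ha, Finset.sum_add_distrib]
      have hsym : ∑ b ∈ s, v b * (X b a * v a) = ∑ b ∈ s, v a * (X a b * v b) :=
        Finset.sum_congr rfl fun b _ => by rw [hX.apply]; ring
      rw [ih, hsym]
      linear_combination (∑ b ∈ s, v a * (X a b * v b)) * hchar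
  simpa only [dotProduct, Matrix.mulVec, Finset.mul_sum] using key Finset.univ

theorem IsSpecializedPseudoPerm.diag_eq_of_ne_zero (hchar : (2 : F) = 0)
    {X Y : Matrix (Fin n) (Fin n) F} (hX : IsSpecializedPseudoPerm X) (hY : IsPseudoPerm Y)
    (hXY : UCongr X Y) {j : Fin n} (hj : X j j ≠ 0) : Y j j = X j j := by
  by_cases hs : ∀ k, X k j ≠ 0 → k = j
  · exact IsPivot.apply_eq_of_uCongr hX.1 hY hXY ⟨le_rfl, hj, hs⟩
  push Not at hs
  obtain ⟨i, hij, hne⟩ := hs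
  have hlt : i < j := hX.1.2.2 j i hne hij hj
  have hYij : Y i j ≠ 0 := by
    rw [hX.1.apply_eq_of_lt_of_ne_zero hY hXY hlt hij]; exact hij
  have hnp := hX.2 i j ⟨hlt, hij, hj⟩
  obtain ⟨h, hh, he⟩ := hXY
  obtain ⟨g, hg, hhg, -⟩ := hh.exists_inverse
  have hXh : X * h = gᵀ * Y := by
    rw [he, Matrix.mul_assoc hᵀ, ← Matrix.mul_assoc, ← Matrix.transpose_mul, hhg,
      Matrix.transpose_one, Matrix.one_mul]
  have hzero : ∀ r < i, (X * h) r j = 0 := by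
    intro r hr
    rw [hXh, Matrix.mul_apply]
    refine Finset.sum_eq_zero fun k _ => ?_
    rw [Matrix.transpose_apply]
    rcases lt_or_ge r k with hk | hk
    · rw [hg.2 k r hk, zero_mul]
    · by_cases h0 : Y k j = 0
      · rw [h0, mul_zero]
      · have hki := hk.trans_lt hr
        exact absurd (hY.2.1 j k i (hki.trans hlt).ne hlt.ne h0 hYij) hki.ne
  have hdiag : Y j j = ∑ k, h k j ^ 2 * X k k := by
    rw [← dotProduct_mulVec_self_of_two_eq_zero hchar hX.1.1 fun k => h k j, he,
      Matrix.mul_assoc]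
    rfl
  rw [hdiag, Finset.sum_eq_single j]
  · rw [hh.1]; ring
  · intro k _ hkj
    by_cases hk0 : X k k = 0
    · rw [hk0, mul_zero]
    suffices h k j = 0 by rw [this]; ring
    rcases lt_or_gt_of_ne hkj with hkj' | hkj'
    swap
    · exact hh.2 k j hkj'
    have row : ∀ m, m < i → X m k ≠ 0 → (∀ l, X m l ≠ 0 → l = k) → h k j = 0 := by
      intro m hm hmk hml
      have h1 := hzero m hm
      rw [Matrix.mul_apply, Finset.sum_eq_single k] at h1
      · exact (mul_eq_zero.1 h1).resolve_left hmk
      · intro l _ hl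
        by_cases h0 : X m l = 0
        · rw [h0, zero_mul]
        · exact absurd (hml l h0) hl
      · simp
    by_cases hks : ∀ m, X m k ≠ 0 → m = k
    · rcases lt_trichotomy k i with hki | hki | hki
      · exact row k hki hk0 fun l hl => hks l (by rwa [hX.1.1.apply])
      · subst hki
        exact absurd (hks j (by rwa [hX.1.1.apply])) hlt.ne'
      · exact absurd (Or.inr ⟨k, ⟨hk0, hks⟩, hki, hkj'⟩) hnp
    · push Not at hks
      obtain ⟨m, hmk, hne'⟩ := hks
      have hmk' : m < k := hX.1.2.2 k m hne' hmk hk0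
      rcases lt_trichotomy m i with hmi | hmi | hmi
      · refine row m hmi hmk fun l hl => ?_
        exact (hX.1.isPivot_of_lt hmk' (by rwa [hX.1.1.apply])).2.2 l (by rwa [hX.1.1.apply])
      · subst hmi
        exact absurd ((hX.1.isPivot_of_lt hlt (by rwa [hX.1.1.apply])).2.2 k
          (by rwa [hX.1.1.apply])) hkj
      · exact absurd (Or.inl ⟨m, k, ⟨hmk', hmk, hk0⟩, hmi, hkj'⟩) hnp
  · simp

theorem IsSpecializedPseudoPerm.eq_of_uCongr (hchar : (2 : F) = 0)
    {X Y : Matrix (Fin n) (Fin n) F} (hX : IsSpecializedPseudoPerm X)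
    (hY : IsSpecializedPseudoPerm Y) (hXY : UCongr X Y) : X = Y := by
  have off : ∀ i j : Fin n, i < j → X i j = Y i j := by
    intro i j hij
    by_cases h0 : X i j = 0
    · by_contra hne
      have hY0 : Y i j ≠ 0 := fun h => hne (h0.trans h.symm)
      exact hne (hY.1.apply_eq_of_lt_of_ne_zero hX.1 hXY.symm hij hY0)
    · exact (hX.1.apply_eq_of_lt_of_ne_zero hY.1 hXY hij h0).symm
  ext i j
  rcases lt_trichotomy i j with hij | rfl | hij
  · exact off i j hij
  · by_cases h0 : X i i = 0
    · by_contra hne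
      have hY0 : Y i i ≠ 0 := fun h => hne (h0.trans h.symm)
      exact hne (hY.diag_eq_of_ne_zero hchar hX.1 hXY.symm hY0)
    · exact (hX.diag_eq_of_ne_zero hchar hY.1 hXY h0).symm
  · rw [← hX.1.1.apply, ← hY.1.1.apply]
    exact off j i hij

/-! ### Existence -/

/-- The leading `m × m` block of `Y`, padded by zeros. -/
def leadingBlock (m : ℕ) (Y : Matrix (Fin n) (Fin n) F) : Matrix (Fin n) (Fin n) F :=
  Matrix.of fun i j => if (i : ℕ) < m ∧ (j : ℕ) < m then Y i j else 0

theorem leadingBlock_apply_of_lt {m : Fin n} (Y : Matrix (Fin n) (Fin n) F) {i j : Fin n}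
    (hi : i < m) (hj : j < m) : leadingBlock m Y i j = Y i j := by
  simp [leadingBlock, hi, hj]

theorem lt_of_leadingBlock_ne_zero {m : Fin n} {Y : Matrix (Fin n) (Fin n) F} {i j : Fin n}
    (h : leadingBlock m Y i j ≠ 0) : i < m ∧ j < m ∧ Y i j ≠ 0 := by
  simpa [leadingBlock, and_assoc] using h

theorem leadingBlock_congr {m : Fin n} {Y Z : Matrix (Fin n) (Fin n) F}
    (h : ∀ i < m, ∀ j < m, Z i j = Y i j) : leadingBlock m Z = leadingBlock m Y := by
  ext i j
  by_cases hij : i < m ∧ j < m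
  · rw [leadingBlock_apply_of_lt Z hij.1 hij.2, leadingBlock_apply_of_lt Y hij.1 hij.2,
      h i hij.1 j hij.2]
  · have : ¬ ((i : ℕ) < m ∧ (j : ℕ) < m) := hij
    simp only [leadingBlock, Matrix.of_apply, if_neg this]

/-- The effect of congruence by a rank one modification of the identity. -/
theorem uCongr_of_rank_one {Y : Matrix (Fin n) (Fin n) F} (hY : Y.IsSymm) (x y : Fin n → F)
    (hxy : ∀ a b, b ≤ a → x a * y b = 0) :
    UCongr Y (Matrix.of fun a b => Y a b + y a * (Y *ᵥ x) b + (Y *ᵥ x) a * y b +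
      y a * y b * (x ⬝ᵥ Y *ᵥ x)) := by
  refine ⟨1 + Matrix.vecMulVec x y, ⟨fun i => ?_, fun i j hij => ?_⟩, ?_⟩
  · simp [Matrix.vecMulVec_apply, hxy i i le_rfl]
  · simp [Matrix.vecMulVec_apply, hxy i j hij.le, hij.ne']
  · have h1 : x ᵥ* Y = Y *ᵥ x := by rw [← Matrix.mulVec_transpose, hY.eq]
    rw [Matrix.transpose_add, Matrix.transpose_one, Matrix.transpose_vecMulVec, Matrix.mul_assoc,
      Matrix.mul_add, Matrix.mul_one, Matrix.add_mul, Matrix.one_mul, Matrix.mul_add,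
      Matrix.mul_vecMulVec, Matrix.vecMulVec_mul, Matrix.vecMulVec_mul_vecMulVec, h1]
    ext a b
    simp only [Matrix.of_apply, Matrix.add_apply, Matrix.vecMulVec_apply, Pi.smul_apply,
      smul_eq_mul, dotProduct_comm x]
    ring

/-- Adding a combination of earlier rows and columns to the row and column `m`. -/
theorem exists_uCongr_add_col (hchar : (2 : F) = 0) {Y : Matrix (Fin n) (Fin n) F}
    (hY : Y.IsSymm) (m : Fin n) (x : Fin n → F) (hx : ∀ a, m ≤ a → x a = 0) :
    ∃ Z, UCongr Y Z ∧ (∀ i < m, ∀ j < m, Z i j = Y i j) ∧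
      (∀ a < m, Z a m = Y a m + (Y *ᵥ x) a) ∧ Z m m = Y m m + x ⬝ᵥ Y *ᵥ x := by
  refine ⟨_, uCongr_of_rank_one hY x (Pi.single m 1) ?_, ?_, ?_, ?_⟩
  · intro a b hba
    by_cases hb : b = m
    · subst hb; rw [hx a hba, zero_mul]
    · simp [hb]
  · intro i hi j hj
    simp [hi.ne, hj.ne]
  · intro a ha
    simp [ha.ne]
  · simp only [Matrix.of_apply, Pi.single_eq_same, one_mul, mul_one]
    linear_combination (Y *ᵥ x) m * hchar

/-- Every nonzero column index of a pseudo-permutation is in its image. -/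
theorem IsPseudoPerm.exists_mulVec_eq_single {P : Matrix (Fin n) (Fin n) F}
    (hP : IsPseudoPerm P) {a b : Fin n} (hb : P b a ≠ 0) : ∃ v, P *ᵥ v = Pi.single a 1 := by
  by_cases hs : ∀ k, P k a ≠ 0 → k = a
  · have hba := hs b hb
    subst hba
    refine ⟨Pi.single b (P b b)⁻¹, ?_⟩
    ext k
    rw [Matrix.mulVec_single]
    by_cases hk : k = b
    · subst hk; simp [hb]
    · have : P k b = 0 := by
        by_contra h0
        exact hk (hs k h0)
      simp [this, hk]
  · push Not at hs
    obtain ⟨c, hc, hca⟩ := hs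
    have hc' : P a c ≠ 0 := by rwa [hP.1.apply]
    have hprod : P a a * P c c = 0 := by
      by_contra h0
      have h1 := hP.2.2 a c hca hc (left_ne_zero_of_mul h0)
      have h2 := hP.2.2 c a hca.symm hc' (right_ne_zero_of_mul h0)
      exact lt_asymm h1 h2
    refine ⟨Pi.single c (P a c)⁻¹ - Pi.single a (P c c * (P a c)⁻¹ ^ 2), ?_⟩
    ext k
    rw [Matrix.mulVec_sub, Matrix.mulVec_single, Matrix.mulVec_single]
    simp only [Pi.sub_apply, Pi.smul_apply, Matrix.col_apply, MulOpposite.smul_eq_mul_unop,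
      MulOpposite.unop_op]
    by_cases hka : k = a
    · subst hka
      rw [Pi.single_eq_same]
      field_simp
      linear_combination -hprod
    · rw [Pi.single_eq_of_ne hka]
      by_cases hkc : k = c
      · subst hkc
        rw [hP.1.apply a k]
        field_simp
        ring
      · have h1 : P k a = 0 := by
          by_contra h0
          exact hkc (hP.2.1 a k c hka hca h0 hc)
        have h2 : P k c = 0 := by
          by_contra h0
          exact hka (hP.2.1 c k a hkc hca.symm h0 hc')
        rw [h1, h2]; ring

theorem IsPseudoPerm.exists_mulVec_eq {P : Matrix (Fin n) (Fin n) F} (hP : IsPseudoPerm P)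
    (c : Fin n → F) : ∃ v, ∀ a, (∃ b, P b a ≠ 0) → (P *ᵥ v) a = c a := by
  classical
  have h1 : ∀ a, ∃ v, (∃ b, P b a ≠ 0) → P *ᵥ v = Pi.single a 1 := by
    intro a
    by_cases ha : ∃ b, P b a ≠ 0
    · obtain ⟨b, hb⟩ := ha
      obtain ⟨v, hv⟩ := hP.exists_mulVec_eq_single hb
      exact ⟨v, fun _ => hv⟩
    · exact ⟨0, fun h => absurd h ha⟩
  choose v hv using h1
  refine ⟨∑ k ∈ Finset.univ.filter (fun k => ∃ b, P b k ≠ 0), c k • v k, fun a ha => ?_⟩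
  rw [Matrix.mulVec_sum, Finset.sum_apply, Finset.sum_eq_single a]
  · rw [Matrix.mulVec_smul, hv a ha]; simp
  · intro k hk hka
    rw [Matrix.mulVec_smul, hv k (Finset.mem_filter.1 hk).2]
    simp [hka.symm]
  · intro h
    exact absurd (Finset.mem_filter.2 ⟨Finset.mem_univ a, ha⟩) h

/-- Column `m` can be cleared at the nonzero rows of the leading block. -/
theorem exists_uCongr_clear (hchar : (2 : F) = 0) {Y : Matrix (Fin n) (Fin n) F} (hY : Y.IsSymm)
    (m : Fin n) (hP : IsPseudoPerm (leadingBlock m Y)) :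
    ∃ Z, UCongr Y Z ∧ (∀ i < m, ∀ j < m, Z i j = Y i j) ∧
      ∀ a < m, (∃ b, leadingBlock m Y b a ≠ 0) → Z a m = 0 := by
  obtain ⟨v, hv⟩ := hP.exists_mulVec_eq fun a => -Y a m
  obtain ⟨Z, hZ, hb, hc, -⟩ := exists_uCongr_add_col hchar hY m
    (fun a => if a < m then v a else 0) (fun a ha => if_neg (not_lt.2 ha))
  refine ⟨Z, hZ, hb, fun a ha hab => ?_⟩
  have h1 : (Y *ᵥ fun a => if a < m then v a else 0) a = (leadingBlock m Y *ᵥ v) a := by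
    simp only [Matrix.mulVec, dotProduct]
    refine Finset.sum_congr rfl fun k _ => ?_
    by_cases hk : k < m
    · rw [if_pos hk, leadingBlock_apply_of_lt Y ha hk]
    · have h0 : leadingBlock m Y a k = 0 := by
        by_contra h0
        exact hk (lt_of_leadingBlock_ne_zero h0).2.1
      rw [if_neg hk, h0]; ring
  rw [hc a ha, h1, hv a hab]; ring

/-- The diagonal entry of column `m` can be killed by any column `l` of the leading block that
has a nonzero diagonal entry and vanishes down to row `i`. -/
theorem exists_uCongr_kill_diag (hchar : (2 : F) = 0) (hsq : ∀ a : F, ∃ b : F, b ^ 2 = a)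
    {Y : Matrix (Fin n) (Fin n) F} (hY : Y.IsSymm) {m i l : Fin n} (hlm : l < m)
    (him : i < m) (hl : Y l l ≠ 0) (hil : ∀ k ≤ i, Y k l = 0) :
    ∃ Z, UCongr Y Z ∧ (∀ i < m, ∀ j < m, Z i j = Y i j) ∧
      (∀ a ≤ i, Z a m = Y a m) ∧ Z m m = 0 := by
  obtain ⟨t, ht⟩ := hsq (Y m m / Y l l)
  obtain ⟨Z, hZ, hb, hc, hd⟩ := exists_uCongr_add_col hchar hY m (Pi.single l t)
    (fun a ha => by rw [Pi.single_eq_of_ne (hlm.trans_le ha).ne'])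
  refine ⟨Z, hZ, hb, fun a ha => ?_, ?_⟩
  · rw [hc a (ha.trans_lt him)]
    simp [hil a ha]
  · have h2 : t * t * Y l l = Y m m := by
      rw [← sq, ht, div_mul_cancel₀ _ hl]
    have h3 : (Pi.single l t : Fin n → F) ⬝ᵥ Y *ᵥ Pi.single l t = t * t * Y l l := by
      simp; ring
    rw [hd, h3, h2]
    linear_combination Y m m * hchar

/-- Column `m` can be cleared below a row `i` that vanishes in the leading block. -/
theorem exists_uCongr_pivot {Y : Matrix (Fin n) (Fin n) F} (hY : Y.IsSymm) {m i : Fin n}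
    (him : i < m) (hi : Y i m ≠ 0) (hlow : ∀ a < i, Y a m = 0) (hrow : ∀ a < m, Y a i = 0) :
    ∃ Z, UCongr Y Z ∧ (∀ i < m, ∀ j < m, Z i j = Y i j) ∧
      (∀ a < m, Z a m ≠ 0 → a = i) ∧ Z m m = Y m m := by
  have hyi : ∀ a, (Y *ᵥ Pi.single i 1) a = Y a i := fun a => by simp
  have hdot : (Pi.single i 1 : Fin n → F) ⬝ᵥ Y *ᵥ Pi.single i 1 = 0 := by
    simp [hrow i him]
  refine ⟨_, uCongr_of_rank_one hY (Pi.single i 1)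
    (fun a => if i < a ∧ a < m then -(Y a m / Y i m) else 0) ?_, ?_, ?_, ?_⟩
  · intro a b hba
    by_cases ha : a = i
    · subst ha
      rw [if_neg (fun h => not_lt_of_ge hba h.1), mul_zero]
    · rw [Pi.single_eq_of_ne ha, zero_mul]
  · intro a ha b hb
    simp only [Matrix.of_apply, hyi, hdot, hrow a ha, hrow b hb]
    ring
  · intro a ha
    contrapose!
    intro hai
    simp only [Matrix.of_apply, hyi, hdot, hrow a ha, hY.apply i m]
    rcases lt_or_gt_of_ne hai with hlt | hgt
    · rw [if_neg (fun h => not_lt_of_gt hlt h.1), hlow a hlt]; ring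
    · rw [if_pos ⟨hgt, ha⟩]
      field_simp
      ring
  · simp

/-- Extending a specialized leading block by one row and column. -/
theorem isSpecializedPseudoPerm_leadingBlock_succ {Y : Matrix (Fin n) (Fin n) F} (hY : Y.IsSymm)
    (m : Fin n) (hP : IsSpecializedPseudoPerm (leadingBlock m Y))
    (huniq : ∀ a < m, ∀ b < m, Y a m ≠ 0 → Y b m ≠ 0 → a = b)
    (hrow : ∀ a < m, Y a m ≠ 0 → ∀ b < m, Y b a = 0)
    (hdiag : ∀ a < m, Y a m ≠ 0 → Y m m ≠ 0 → ∀ l < m, Y l l ≠ 0 → ∃ k ≤ a, Y k l ≠ 0) :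
    IsSpecializedPseudoPerm (leadingBlock (m + 1) Y) := by
  have hQ : ∀ {i j : Fin n}, leadingBlock (m + 1) Y i j ≠ 0 ↔ i ≤ m ∧ j ≤ m ∧ Y i j ≠ 0 := by
    intro i j
    simp [leadingBlock]
  have hP' : ∀ {i j : Fin n}, leadingBlock m Y i j ≠ 0 ↔ i < m ∧ j < m ∧ Y i j ≠ 0 := by
    intro i j
    simp [leadingBlock]
  have hsymm : ∀ {i j : Fin n}, Y i j ≠ 0 → Y j i ≠ 0 := fun h => by rwa [hY.apply]
  obtain ⟨⟨-, hP1, hP2⟩, hP3⟩ := hP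
  have hpair : ∀ {k l : Fin n}, l < m → XPair (leadingBlock (m + 1) Y) k l →
      XPair (leadingBlock m Y) k l := fun hl h =>
    ⟨h.1, hP'.2 ⟨h.1.trans hl, hl, (hQ.1 h.2.1).2.2⟩, hP'.2 ⟨hl, hl, (hQ.1 h.2.2).2.2⟩⟩
  have hindex : ∀ {s : Fin n}, s < m → XIndex (leadingBlock (m + 1) Y) s →
      XIndex (leadingBlock m Y) s := fun hs h =>
    ⟨hP'.2 ⟨hs, hs, (hQ.1 h.1).2.2⟩, fun i hi =>
      h.2 i (hQ.2 ⟨(hP'.1 hi).1.le, hs.le, (hP'.1 hi).2.2⟩)⟩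
  refine ⟨⟨?_, ?_, ?_⟩, ?_⟩
  · ext i j
    simp only [Matrix.transpose_apply, leadingBlock, Matrix.of_apply, hY.apply i j,
      and_comm (a := (j : ℕ) < m + 1)]
  · intro j i k hij hkj hi' hk'
    obtain ⟨him, hjm, hi⟩ := hQ.1 hi'
    obtain ⟨hkm, -, hk⟩ := hQ.1 hk'
    rcases hjm.lt_or_eq with hjm | rfl
    · rcases him.lt_or_eq with him | rfl <;> rcases hkm.lt_or_eq with hkm | rfl
      · exact hP1 j i k hij hkj (hP'.2 ⟨him, hjm, hi⟩) (hP'.2 ⟨hkm, hjm, hk⟩)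
      · exact absurd (hrow j hjm (hsymm hk) i him) hi
      · exact absurd (hrow j hjm (hsymm hi) k hkm) hk
      · rfl
    · exact huniq i (lt_of_le_of_ne him hij) k (lt_of_le_of_ne hkm hkj) hi hk
  · intro j i hij hi' hj'
    obtain ⟨him, hjm, hi⟩ := hQ.1 hi'
    obtain ⟨-, -, hj⟩ := hQ.1 hj'
    rcases hjm.lt_or_eq with hjm | rfl
    · rcases him.lt_or_eq with him | rfl
      · exact hP2 j i hij (hP'.2 ⟨him, hjm, hi⟩) (hP'.2 ⟨hjm, hjm, hj⟩)
      · exact absurd (hrow j hjm (hsymm hi) j hjm) hj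
    · exact lt_of_le_of_ne him hij
  · intro i j hij hprob
    obtain ⟨-, hjm, hi⟩ := hQ.1 hij.2.1
    rcases hjm.lt_or_eq with hjm | rfl
    · refine hP3 i j (hpair hjm hij) ?_
      rcases hprob with ⟨k, l, hkl, hik, hlj⟩ | ⟨s, hs, his, hsj⟩
      · exact Or.inl ⟨k, l, hpair (hlj.trans hjm) hkl, hik, hlj⟩
      · exact Or.inr ⟨s, hindex (hsj.trans hjm) hs, his, hsj⟩
    · have hd := hdiag i hij.1 hi (hQ.1 hij.2.2).2.2
      rcases hprob with ⟨k, l, hkl, hik, hlj⟩ | ⟨s, hs, his, hsj⟩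
      · have hkl' := hpair hlj hkl
        obtain ⟨r, hri, hr⟩ := hd l hlj (hP'.1 hkl'.2.2).2.2
        have hrk := hri.trans_lt hik
        exact hrk.ne (hP1 l r k (hrk.trans hkl.1).ne hkl.1.ne
          (hP'.2 ⟨hri.trans_lt hij.1, hlj, hr⟩) hkl'.2.1)
      · have hs' := hindex hsj hs
        obtain ⟨r, hri, hr⟩ := hd s hsj (hP'.1 hs'.1).2.2
        exact (hri.trans_lt his).ne (hs'.2 r (hP'.2 ⟨hri.trans_lt hij.1, hsj, hr⟩))

theorem exists_uCongr_leadingBlock_succ (hchar : (2 : F) = 0)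
    (hsq : ∀ a : F, ∃ b : F, b ^ 2 = a) {Y : Matrix (Fin n) (Fin n) F} (hY : Y.IsSymm)
    (m : Fin n) (hP : IsSpecializedPseudoPerm (leadingBlock m Y)) :
    ∃ Z, UCongr Y Z ∧ IsSpecializedPseudoPerm (leadingBlock (m + 1) Z) := by
  obtain ⟨Z, hYZ, hZb, hZ0⟩ := exists_uCongr_clear hchar hY m hP.1
  rw [← leadingBlock_congr hZb] at hP hZ0
  have hZs := hYZ.isSymm hY
  by_cases hcol : ∃ a, a < m ∧ Z a m ≠ 0
  swap
  · push Not at hcol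
    exact ⟨Z, hYZ, isSpecializedPseudoPerm_leadingBlock_succ hZs m hP
      (fun a ha _ _ h => absurd (hcol a ha) h) (fun a ha h => absurd (hcol a ha) h)
      (fun a ha h => absurd (hcol a ha) h)⟩
  obtain ⟨i, ⟨him, hi⟩, hmin⟩ := exists_minimal_of_wellFoundedLT _ hcol
  have hlow : ∀ a < i, Z a m = 0 := by
    intro a ha
    by_contra h0
    exact not_le_of_gt ha (hmin ⟨ha.trans him, h0⟩ ha.le)
  have hrow : ∀ a < m, Z a i = 0 := by
    intro a ha
    by_contra h0
    exact hi (hZ0 i him ⟨a, by rwa [leadingBlock_apply_of_lt Z ha him]⟩)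
  obtain ⟨W, hZW, hWb, hWc, hWd⟩ : ∃ W, UCongr Z W ∧ (∀ i < m, ∀ j < m, W i j = Z i j) ∧
      (∀ a ≤ i, W a m = Z a m) ∧
      (W m m ≠ 0 → ∀ l < m, Z l l ≠ 0 → ∃ k ≤ i, Z k l ≠ 0) := by
    by_cases hl : ∃ l < m, Z l l ≠ 0 ∧ ∀ k ≤ i, Z k l = 0
    · obtain ⟨l, hlm, hll, hkl⟩ := hl
      obtain ⟨W, h1, h2, h3, h4⟩ := exists_uCongr_kill_diag hchar hsq hZs hlm him hll hkl
      exact ⟨W, h1, h2, h3, fun h => absurd h4 h⟩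
    · push Not at hl
      exact ⟨Z, UCongr.refl Z, fun _ _ _ _ => rfl, fun _ _ => rfl, fun _ => hl⟩
  have hWs := hZW.isSymm hZs
  obtain ⟨V, hWV, hVb, hVc, hVd⟩ := exists_uCongr_pivot hWs him
    (by rwa [hWc i le_rfl]) (fun a ha => by rw [hWc a ha.le, hlow a ha])
    (fun a ha => by rw [hWb a ha i him, hrow a ha])
  have hVZ : ∀ a < m, ∀ b < m, V a b = Z a b := fun a ha b hb => by
    rw [hVb a ha b hb, hWb a ha b hb]
  rw [← leadingBlock_congr hVZ] at hP
  refine ⟨V, hYZ.trans (hZW.trans hWV), isSpecializedPseudoPerm_leadingBlock_succ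
    (hWV.isSymm hWs) m hP ?_ ?_ ?_⟩
  · intro a ha b hb h1 h2
    rw [hVc a ha h1, hVc b hb h2]
  · intro a ha h1 b hb
    rw [hVc a ha h1, hVZ b hb i him, hrow b hb]
  · intro a ha h1 h2 l hl hll
    rw [hVZ l hl l hl] at hll
    obtain ⟨k, hk, hkl⟩ := hWd (hVd ▸ h2) l hl hll
    exact ⟨k, by rwa [hVc a ha h1], by rwa [hVZ k (hk.trans_lt him) l hl]⟩

theorem exists_uCongr_isSpecializedPseudoPerm (hchar : (2 : F) = 0)
    (hsq : ∀ a : F, ∃ b : F, b ^ 2 = a) {X : Matrix (Fin n) (Fin n) F} (hX : X.IsSymm) :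
    ∃ Y, UCongr X Y ∧ IsSpecializedPseudoPerm Y := by
  have key : ∀ m ≤ n, ∃ Y, UCongr X Y ∧ IsSpecializedPseudoPerm (leadingBlock m Y) := by
    intro m
    induction m with
    | zero =>
      intro _
      refine ⟨X, UCongr.refl X, ?_⟩
      have h0 : leadingBlock 0 X = 0 := by ext; simp [leadingBlock]
      rw [h0]
      refine ⟨⟨Matrix.isSymm_zero, ?_, ?_⟩, ?_⟩
      · intro j i k _ _ h
        exact absurd rfl h
      · intro j i _ h
        exact absurd rfl h
      · intro i j h
        exact absurd rfl h.2.1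
    | succ m ih =>
      intro hm
      obtain ⟨Y, hXY, hY⟩ := ih (Nat.le_of_succ_le hm)
      obtain ⟨Z, hYZ, hZ⟩ := exists_uCongr_leadingBlock_succ hchar hsq (hXY.isSymm hX)
        ⟨m, hm⟩ hY
      exact ⟨Z, hXY.trans hYZ, hZ⟩
  obtain ⟨Y, hXY, hY⟩ := key n le_rfl
  have hn : leadingBlock n Y = Y := by ext; simp [leadingBlock]
  exact ⟨Y, hXY, hn ▸ hY⟩

/-- If `char F = 2` and every element of `F` is a square, every symmetric matrix
is `U`-congruent to a unique specialized pseudo-permutation matrix. -/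
theorem symm_unique_specialized_U_congruent (hn : 2 ≤ n) (hchar : (2 : F) = 0)
    (hsq : ∀ a : F, ∃ b : F, b ^ 2 = a)
    (X : Matrix (Fin n) (Fin n) F) (hX : X.IsSymm) :
    ∃! Y : Matrix (Fin n) (Fin n) F, IsSpecializedPseudoPerm Y ∧
      ∃ h : Matrix (Fin n) (Fin n) F, InU h ∧ Y = hᵀ * X * h := by
  obtain ⟨Y, hXY, hY⟩ := exists_uCongr_isSpecializedPseudoPerm hchar hsq hX
  exact ⟨Y, ⟨hY, hXY⟩, fun Z ⟨hZ, hXZ⟩ =>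
    hZ.eq_of_uCongr hchar hY ((UCongr.symm hXZ).trans hXY)⟩
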